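/- Every IR-calc refutation of Φ_n and every IR-calc refutation of Ω_n has size superpolynomial in n: for every polynomial q, for all sufficiently large n, every IR-calc refutation of Φ_n has size greater than q(n), and every IR-calc refutation of Ω_n has size greater than q(n). -/

import Mathlib

/-! ## Propositional / QBF side -/

inductive Lit where
  | pos (x : ℕ)
  | neg (x : ℕ)
deriving DecidableEq

def Lit.var : Lit → ℕ
  | pos x => x
  | neg x => x

def Lit.isPos : Lit → Bool
  | pos _ => true
  | neg _ => false

def Lit.negate : Lit → Lit
  | pos x => neg x
  | neg x => pos x

def Lit.eval (v : ℕ → Bool) : Lit → Bool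
  | pos x => v x
  | neg x => !(v x)

abbrev Clause := Finset Lit

def Clause.Taut (C : Clause) : Prop := ∃ x, Lit.pos x ∈ C ∧ Lit.neg x ∈ C

/-- A prenex CNF: a list of quantifier blocks (`true` = existential,
`false` = universal), each with an ordered list of variables, and a matrix
which is a finite set of clauses. -/
structure PCNF where
  blocks : List (Bool × List ℕ)
  matrix : Finset Clause

def PCNF.allVars (Φ : PCNF) : List ℕ := Φ.blocks.flatMap (·.2)

/-- Well-formedness: quantifier blocks alternate and the blocks are
pairwise disjoint sets of variables (no repetitions). -/
def PCNF.WF (Φ : PCNF) : Prop :=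
  List.Chain' (fun a b => a.1 ≠ b.1) Φ.blocks ∧ Φ.allVars.Nodup ∧
    ∀ b ∈ Φ.blocks, b.2 ≠ []

/-- Closedness: every variable of the matrix is quantified in the prefix. -/
def PCNF.Closed (Φ : PCNF) : Prop :=
  ∀ C ∈ Φ.matrix, ∀ l ∈ C, l.var ∈ Φ.allVars

def PCNF.existB (Φ : PCNF) (x : ℕ) : Bool :=
  Φ.blocks.any fun b => b.1 && b.2.contains x

def PCNF.univB (Φ : PCNF) (x : ℕ) : Bool :=
  Φ.blocks.any fun b => !b.1 && b.2.contains x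

/-- The level of a variable: the index of its quantifier block. -/
def PCNF.lv (Φ : PCNF) (x : ℕ) : ℕ :=
  Φ.blocks.findIdx fun b => b.2.contains x

def evalClause (v : ℕ → Bool) (C : Clause) : Prop := ∃ l ∈ C, l.eval v = true

/-- Standard QBF semantics of a prenex CNF, evaluated block by block. -/
def truthAux (M : Finset Clause) : List (Bool × List ℕ) → (ℕ → Bool) → Prop
  | [], v => ∀ C ∈ M, evalClause v C
  | (q, xs) :: rest, v =>
      if q then ∃ w : ℕ → Bool, (∀ y, y ∉ xs → w y = v y) ∧ truthAux M rest w
      else ∀ w : ℕ → Bool, (∀ y, y ∉ xs → w y = v y) → truthAux M rest w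

def PCNF.IsTrue (Φ : PCNF) : Prop := truthAux Φ.matrix Φ.blocks fun _ => false

/-! ## Q-resolution and QU-resolution -/

/-- One derivation step of Q-res (`univPivot = false`) resp. QU-res
(`univPivot = true`) from the clauses derived so far. -/
inductive QStep (Φ : PCNF) (univPivot : Bool) (prev : List Clause) : Clause → Prop
  | ax (C : Clause) (hC : C ∈ Φ.matrix) (hnt : ¬ C.Taut) : QStep Φ univPivot prev C
  | res (x : ℕ) (A B : Clause) (hA : A ∈ prev) (hB : B ∈ prev)
      (hxa : Lit.pos x ∈ A) (hxb : Lit.neg x ∈ B)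
      (hpiv : Φ.existB x = true ∨ (univPivot = true ∧ Φ.univB x = true))
      (hblock : ∀ l ∈ A.erase (Lit.pos x), l.negate ∉ B.erase (Lit.neg x)) :
      QStep Φ univPivot prev ((A.erase (Lit.pos x)) ∪ (B.erase (Lit.neg x)))
  | fac (A : Clause) (hA : A ∈ prev) : QStep Φ univPivot prev A
  | univRed (A : Clause) (m : Lit) (hA : A ∈ prev) (hm : m ∈ A)
      (hu : Φ.univB m.var = true)
      (hlv : ∀ l ∈ A.erase m, Φ.existB l.var = true → Φ.lv l.var < Φ.lv m.var) :
      QStep Φ univPivot prev (A.erase m)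

def QValid (Φ : PCNF) (univPivot : Bool) (π : List Clause) : Prop :=
  ∀ i < π.length, QStep Φ univPivot (π.take i) π[i]!

def QRefutation (Φ : PCNF) (univPivot : Bool) (π : List Clause) : Prop :=
  QValid Φ univPivot π ∧ π ≠ [] ∧ π.getLast! = (∅ : Clause)

/-- Size of a (QBF) resolution derivation: total number of literal
occurrences in its clauses. -/
def qSize (π : List Clause) : ℕ := (π.map Finset.card).sum

/-! ## First-order terms, atoms, literals, clauses -/

inductive FTerm where
  | var (x : ℕ)
  | app (f : ℕ) (args : List FTerm)

noncomputable instance : DecidableEq FTerm := Classical.decEq _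

def FTerm.subst (σ : ℕ → FTerm) : FTerm → FTerm
  | .var x => σ x
  | .app f args => .app f (args.attach.map fun t => t.1.subst σ)
decreasing_by
  have := List.sizeOf_lt_of_mem t.2
  simp only [FTerm.app.sizeOf_spec]; omega

def FTerm.symSize : FTerm → ℕ
  | .var _ => 1
  | .app _ args => 1 + (args.attach.map fun t => t.1.symSize).sum
decreasing_by
  have := List.sizeOf_lt_of_mem t.2
  simp only [FTerm.app.sizeOf_spec]; omega

def FTerm.vars : FTerm → Finset ℕ
  | .var x => {x}
  | .app _ args => (args.attach.map fun t => t.1.vars).foldr (· ∪ ·) ∅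
decreasing_by
  have := List.sizeOf_lt_of_mem t.2
  simp only [FTerm.app.sizeOf_spec]; omega

/-- An atom `p(t₁,…,t_k)`: predicate symbol together with argument list. -/
structure FAtom where
  p : ℕ
  args : List FTerm

noncomputable instance : DecidableEq FAtom := Classical.decEq _

def FAtom.subst (σ : ℕ → FTerm) (a : FAtom) : FAtom := ⟨a.p, a.args.map (FTerm.subst σ)⟩
def FAtom.symSize (a : FAtom) : ℕ := 1 + (a.args.map FTerm.symSize).sum
def FAtom.vars (a : FAtom) : Finset ℕ := (a.args.map FTerm.vars).foldr (· ∪ ·) ∅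

inductive FLit where
  | pos (a : FAtom)
  | neg (a : FAtom)

noncomputable instance : DecidableEq FLit := Classical.decEq _

def FLit.atom : FLit → FAtom
  | pos a => a
  | neg a => a

def FLit.isPos : FLit → Bool
  | pos _ => true
  | neg _ => false

def FLit.subst (σ : ℕ → FTerm) : FLit → FLit
  | pos a => pos (a.subst σ)
  | neg a => neg (a.subst σ)

def FLit.symSize (l : FLit) : ℕ :=
  match l with
  | .pos a => a.symSize
  | .neg a => 1 + a.symSize

abbrev FClause := Finset FLit

noncomputable def FClause.subst (σ : ℕ → FTerm) (C : FClause) : FClause :=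
  C.image (FLit.subst σ)

noncomputable def FClause.symSize (C : FClause) : ℕ := ∑ l ∈ C, l.symSize

noncomputable def FClause.fvars (C : FClause) : Finset ℕ := C.sup fun l => l.atom.vars

/-! ## First-order resolution R1 -/

def compSub (σ μ : ℕ → FTerm) : ℕ → FTerm := fun x => (σ x).subst μ

def Unifies (σ : ℕ → FTerm) (a b : FAtom) : Prop := a.subst σ = b.subst σ

def IsMGU (σ : ℕ → FTerm) (a b : FAtom) : Prop :=
  Unifies σ a b ∧ ∀ τ, Unifies τ a b → ∃ μ, ∀ x, compSub σ μ x = τ x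

/-- `D` is a factor of `C`: `D = Cσ` for `σ` an mgu of two distinct
same-sign literals of `C`. -/
def IsFactor (C D : FClause) : Prop :=
  ∃ K L σ, K ∈ C ∧ L ∈ C ∧ K ≠ L ∧ K.isPos = L.isPos ∧
    IsMGU σ K.atom L.atom ∧ D = C.subst σ

def renameSub (ρ : ℕ → ℕ) : ℕ → FTerm := fun x => .var (ρ x)

/-- `E` is a resolvent of `C` and `D`. -/
def IsResolvent (C D E : FClause) : Prop :=
  ∃ ρ : ℕ → ℕ, Function.Injective ρ ∧
    ∃ K L σ, Disjoint C.fvars (FClause.subst (renameSub ρ) D).fvars ∧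
      K ∈ C ∧ L ∈ FClause.subst (renameSub ρ) D ∧ K.isPos = !L.isPos ∧
      IsMGU σ K.atom L.atom ∧
      E = ((C.subst σ).erase (K.subst σ)) ∪
          (((FClause.subst (renameSub ρ) D).subst σ).erase (L.subst σ))

def R1Valid (S : Set FClause) (π : List FClause) : Prop :=
  ∀ i < π.length,
    π[i]! ∈ S ∨ (∃ j < i, IsFactor π[j]! π[i]!) ∨
      (∃ j < i, ∃ k < i, IsResolvent π[j]! π[k]! π[i]!)

def R1Refutation (S : Set FClause) (π : List FClause) : Prop :=
  R1Valid S π ∧ π ≠ [] ∧ π.getLast! = (∅ : FClause)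

noncomputable def r1Size (π : List FClause) : ℕ := (π.map FClause.symSize).sum

/-- Tree-form R1 refutations: every clause occurrence is used at most once
as a premise, which is inherent in a tree-structured derivation. -/
inductive R1Tree (S : Set FClause) : FClause → Type
  | input (C : FClause) (h : C ∈ S) : R1Tree S C
  | factor {C : FClause} (t : R1Tree S C) (D : FClause) (h : IsFactor C D) : R1Tree S D
  | resolve {C D : FClause} (t₁ : R1Tree S C) (t₂ : R1Tree S D) (E : FClause)
      (h : IsResolvent C D E) : R1Tree S E

noncomputable def R1Tree.size {S : Set FClause} : {C : FClause} → R1Tree S C → ℕ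
  | C, .input _ _ => C.symSize
  | D, .factor t _ _ => t.size + D.symSize
  | E, .resolve t₁ t₂ _ _ => t₁.size + t₂.size + E.symSize

def R1Tree.clauseCount {S : Set FClause} : {C : FClause} → R1Tree S C → ℕ
  | _, .input _ _ => 1
  | _, .factor t _ _ => t.clauseCount + 1
  | _, .resolve t₁ t₂ _ _ => t₁.clauseCount + t₂.clauseCount + 1

/-! ## The Skolem and EPR translations -/

/-- The universal variables strictly preceding `a` in the prefix,
in prefix order. -/
def PCNF.univBefore (Φ : PCNF) (a : ℕ) : List ℕ :=
  ((Φ.blocks.flatMap fun b => b.2.map fun x => (b.1, x)).takeWhile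
      fun p => p.2 ≠ a).filterMap
    fun p => if p.1 = false then some p.2 else none

/-- `p` is the predicate symbol `0`; `f₀`, `f₁` are the constants `0`, `1`;
the Skolem function symbol for existential variable `a` is `a + 2`. -/
def skAtom (Φ : PCNF) (x : ℕ) : FAtom :=
  if Φ.existB x then ⟨0, [FTerm.app (x + 2) ((Φ.univBefore x).map FTerm.var)]⟩
  else ⟨0, [FTerm.var x]⟩

def skLit (Φ : PCNF) : Lit → FLit
  | .pos x => .pos (skAtom Φ x)
  | .neg x => .neg (skAtom Φ x)

noncomputable def skClause (Φ : PCNF) (C : Clause) : FClause := C.image (skLit Φ)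

def pf1Cl : FClause := {FLit.pos ⟨0, [FTerm.app 1 []]⟩}
def npf0Cl : FClause := {FLit.neg ⟨0, [FTerm.app 0 []]⟩}

/-- The clause set `Sk(Φ) ∪ {p(f₁), ¬p(f₀)}`. -/
noncomputable def skSet (Φ : PCNF) : Set FClause :=
  ↑(Φ.matrix.image (skClause Φ)) ∪ {pf1Cl, npf0Cl}

/-- EPR atom: `p(f_a(u₁,…,u_k))` with `k ≥ 1` becomes `p_a(u₁,…,u_k)`,
where the fresh predicate symbol `p_a` is `a + 1`. -/
def eprAtom (Φ : PCNF) (x : ℕ) : FAtom :=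
  if Φ.existB x then
    if Φ.univBefore x = [] then ⟨0, [FTerm.app (x + 2) []]⟩
    else ⟨x + 1, (Φ.univBefore x).map FTerm.var⟩
  else ⟨0, [FTerm.var x]⟩

def eprLit (Φ : PCNF) : Lit → FLit
  | .pos x => .pos (eprAtom Φ x)
  | .neg x => .neg (eprAtom Φ x)

noncomputable def eprClause (Φ : PCNF) (C : Clause) : FClause := C.image (eprLit Φ)

/-- The clause set `EPR(Φ) ∪ {p(f₁), ¬p(f₀)}`. -/
noncomputable def eprSet (Φ : PCNF) : Set FClause :=
  ↑(Φ.matrix.image (eprClause Φ)) ∪ {pf1Cl, npf0Cl}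

/-! ## IR-calc and its extensions -/

/-- An annotation: a (functional) finite set of assignments
`universal variable ↦ 0/1` (`false` = 0, `true` = 1). -/
abbrev Ann := Finset (ℕ × Bool)

def Ann.Functional (τ : Ann) : Prop := ∀ x b b', (x, b) ∈ τ → (x, b') ∈ τ → b = b'

/-- Restriction `[σ]` of an annotation to the universal variables of level
below the level of the literal `l`. -/
def annRestr (Φ : PCNF) (σ : Ann) (l : Lit) : Ann :=
  σ.filter fun p => Φ.lv p.1 < Φ.lv l.var

/-- Completion of `μ` by `τ`. -/
def annCompl (μ τ : Ann) : Ann :=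
  μ ∪ τ.filter fun p => p.1 ∉ μ.image Prod.fst

structure ALit where
  lit : Lit
  ann : Ann
deriving DecidableEq

abbrev AClause := Finset ALit

def ALit.symSize (al : ALit) : ℕ := 1 + 2 * al.ann.card
def AClause.symSize (A : AClause) : ℕ := ∑ al ∈ A, al.symSize
def aSize (π : List AClause) : ℕ := (π.map AClause.symSize).sum

/-- The annotation extracted from the universal literals of a clause:
`u ↦ 0` for positive and `u ↦ 1` for negative universal literals. -/
def axAnn (Φ : PCNF) (C : Clause) : Ann :=
  (C.filter fun l => Φ.univB l.var).image fun l =>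
    match l with
    | .pos u => (u, false)
    | .neg u => (u, true)

/-- The axiom clause of IR-calc obtained from a matrix clause. -/
def axClause (Φ : PCNF) (C : Clause) : AClause :=
  (C.filter fun l => Φ.existB l.var).image fun l => ⟨l, annRestr Φ (axAnn Φ C) l⟩

/-- Application of a variable substitution `σ_v` (universal ↦ existential)
to a literal. -/
def applySigv (σv : ℕ → Option ℕ) : Lit → Lit
  | .pos x => match σv x with | some e => .pos e | none => .pos x
  | .neg x => match σv x with | some e => .neg e | none => .neg x

def Clause.applySigv (σv : ℕ → Option ℕ) (C : Clause) : Clause :=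
  C.image (_root_.applySigv σv)

/-- Admissibility of `σ_v`: it maps universal variables to existential
variables of strictly smaller level. -/
def Admissible (Φ : PCNF) (σv : ℕ → Option ℕ) : Prop :=
  ∀ x e, σv x = some e → Φ.univB x = true ∧ Φ.existB e = true ∧ Φ.lv e < Φ.lv x

/-- One step of IR-calc(P, M, Δ, σ_v).  Plain IR-calc is the instance with
`Δ = ∅` and `σv = fun _ => none`; IR-calc^{σ_v} the instance with `Δ = ∅`. -/
inductive IRStep (Φ : PCNF) (Δ : Finset Clause) (σv : ℕ → Option ℕ)
    (prev : List AClause) : AClause → Prop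
  | ax (C : Clause) (hC : C ∈ Φ.matrix) (hnt : ¬ C.Taut)
      (hnt' : ¬ (C.applySigv σv).Taut) :
      IRStep Φ Δ σv prev (axClause Φ (C.applySigv σv))
  | axExt (C : Clause) (hC : C ∈ Δ) (hnt : ¬ C.Taut) :
      IRStep Φ Δ σv prev (C.image fun l => ⟨l, ∅⟩)
  | res (x : ℕ) (τ : Ann) (A B : AClause) (hA : A ∈ prev) (hB : B ∈ prev)
      (hxa : (⟨Lit.pos x, τ⟩ : ALit) ∈ A) (hxb : (⟨Lit.neg x, τ⟩ : ALit) ∈ B) :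
      IRStep Φ Δ σv prev ((A.erase ⟨Lit.pos x, τ⟩) ∪ (B.erase ⟨Lit.neg x, τ⟩))
  | fac (A : AClause) (hA : A ∈ prev) : IRStep Φ Δ σv prev A
  | inst (A : AClause) (τ : Ann) (hA : A ∈ prev) (hfun : τ.Functional)
      (hdom : ∀ p ∈ τ, Φ.univB p.1 = true) :
      IRStep Φ Δ σv prev
        (A.image fun al => ⟨al.lit, annRestr Φ (annCompl al.ann τ) al.lit⟩)

def IRValid (Φ : PCNF) (Δ : Finset Clause) (σv : ℕ → Option ℕ)
    (π : List AClause) : Prop :=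
  ∀ i < π.length, IRStep Φ Δ σv (π.take i) π[i]!

def IRRefutation (Φ : PCNF) (Δ : Finset Clause) (σv : ℕ → Option ℕ)
    (π : List AClause) : Prop :=
  IRValid Φ Δ σv π ∧ π ≠ [] ∧ π.getLast! = (∅ : AClause)

def noSub : ℕ → Option ℕ := fun _ => none

/-- Tree-form IR-calc(P, M, Δ, σ_v) derivations. -/
inductive IRTree (Φ : PCNF) (Δ : Finset Clause) (σv : ℕ → Option ℕ) : AClause → Type
  | ax (C : Clause) (hC : C ∈ Φ.matrix) (hnt : ¬ C.Taut)
      (hnt' : ¬ (C.applySigv σv).Taut) : IRTree Φ Δ σv (axClause Φ (C.applySigv σv))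
  | axExt (C : Clause) (hC : C ∈ Δ) (hnt : ¬ C.Taut) :
      IRTree Φ Δ σv (C.image fun l => ⟨l, ∅⟩)
  | res {A B : AClause} (t₁ : IRTree Φ Δ σv A) (t₂ : IRTree Φ Δ σv B)
      (x : ℕ) (τ : Ann)
      (hxa : (⟨Lit.pos x, τ⟩ : ALit) ∈ A) (hxb : (⟨Lit.neg x, τ⟩ : ALit) ∈ B) :
      IRTree Φ Δ σv ((A.erase ⟨Lit.pos x, τ⟩) ∪ (B.erase ⟨Lit.neg x, τ⟩))
  | inst {A : AClause} (t : IRTree Φ Δ σv A) (τ : Ann) (hfun : τ.Functional)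
      (hdom : ∀ p ∈ τ, Φ.univB p.1 = true) :
      IRTree Φ Δ σv (A.image fun al => ⟨al.lit, annRestr Φ (annCompl al.ann τ) al.lit⟩)

def IRTree.size {Φ : PCNF} {Δ : Finset Clause} {σv : ℕ → Option ℕ} :
    {A : AClause} → IRTree Φ Δ σv A → ℕ
  | _, .ax C _ _ _ => AClause.symSize (axClause Φ (C.applySigv σv))
  | _, .axExt C _ _ => AClause.symSize (C.image fun l => (⟨l, ∅⟩ : ALit))
  | _, .res (A := A) (B := B) t₁ t₂ x τ _ _ =>
      t₁.size + t₂.size +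
        AClause.symSize ((A.erase ⟨Lit.pos x, τ⟩) ∪ (B.erase ⟨Lit.neg x, τ⟩))
  | _, .inst (A := A) t τ _ _ =>
      t.size + AClause.symSize (A.image fun al =>
        (⟨al.lit, annRestr Φ (annCompl al.ann τ) al.lit⟩ : ALit))

/-! ## The formula families Φ_n and Ω_n (pigeonhole based) -/

def xv (i j : ℕ) : ℕ := Nat.pair 0 (Nat.pair i (Nat.pair j 0))
def yv (i j : ℕ) : ℕ := Nat.pair 1 (Nat.pair i (Nat.pair j 0))
def zv (i₁ i₂ j : ℕ) : ℕ := Nat.pair 2 (Nat.pair i₁ (Nat.pair i₂ j))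

def Xlist (n : ℕ) : List ℕ :=
  (List.range (n+1)).flatMap fun i => (List.range n).map fun j => xv (i+1) (j+1)
def Ylist (n : ℕ) : List ℕ :=
  (List.range (n+1)).flatMap fun i => (List.range n).map fun j => yv (i+1) (j+1)
def Zlist (n : ℕ) : List ℕ :=
  ((List.range (n+1)).map fun i => zv (i+1) 0 0) ++
  ((List.range n).flatMap fun j => (List.range (n+1)).flatMap fun i₁ =>
    (List.range (n+1)).filterMap fun i₂ =>
      if i₁ < i₂ then some (zv (i₁+1) (i₂+1) (j+1)) else none)

/-- The clauses of PHP_n(X_n). -/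
def PHPcls (n : ℕ) : Finset Clause :=
  ((List.range (n+1)).map fun i =>
      (((List.range n).map fun j => Lit.pos (xv (i+1) (j+1))).toFinset : Clause)).toFinset ∪
  ((List.range n).flatMap fun j => (List.range (n+1)).flatMap fun i₁ =>
    (List.range (n+1)).filterMap fun i₂ =>
      if i₁ < i₂ then
        some ({Lit.neg (xv (i₁+1) (j+1)), Lit.neg (xv (i₂+1) (j+1))} : Clause)
      else none).toFinset

/-- The clauses of TPHP′_n(Y_n, Z_n). -/
def TPHPcls (n : ℕ) : Finset Clause :=
  {(((Zlist n).map Lit.neg).toFinset : Clause)} ∪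
  ((List.range (n+1)).flatMap fun i => (List.range n).map fun j =>
      ({Lit.pos (zv (i+1) 0 0), Lit.neg (yv (i+1) (j+1))} : Clause)).toFinset ∪
  ((List.range n).flatMap fun j => (List.range (n+1)).flatMap fun i₁ =>
    (List.range (n+1)).flatMap fun i₂ =>
      if i₁ < i₂ then
        [({Lit.pos (zv (i₁+1) (i₂+1) (j+1)), Lit.pos (yv (i₁+1) (j+1))} : Clause),
         ({Lit.pos (zv (i₁+1) (i₂+1) (j+1)), Lit.pos (yv (i₂+1) (j+1))} : Clause)]
      else []).toFinset

def phiMatrix (n : ℕ) : Finset Clause := TPHPcls n ∪ PHPcls n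

/-- Φ_n = ∃X_n ∀Y_n ∃Z_n (TPHP′_n ∧ PHP_n). -/
def PhiF (n : ℕ) : PCNF :=
  ⟨[(true, Xlist n), (false, Ylist n), (true, Zlist n)], phiMatrix n⟩

/-- Ω_n = ∀Y_n ∃Z_n ∃X_n (TPHP′_n ∧ PHP_n) (Z_n and X_n form one block). -/
def OmegaF (n : ℕ) : PCNF :=
  ⟨[(false, Ylist n), (true, Zlist n ++ Xlist n)], phiMatrix n⟩

/-! ## The formula family Ψ_t of Kleine Büning, Karpinski and Flögel -/

def dv (j : ℕ) : ℕ := 5*j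
def ev (j : ℕ) : ℕ := 5*j+1
def xvv (j : ℕ) : ℕ := 5*j+2
def fv (j : ℕ) : ℕ := 5*j+3
def qv (j : ℕ) : ℕ := 5*j+4

/-- The prefix P_t; if `withQ` is set, the fresh extension variable `q_i`
is placed in the same existential block as `d_i` and `e_i`. -/
def psiPrefix (t : ℕ) (withQ : Bool) : List (Bool × List ℕ) :=
  ((true, [dv 0, dv 1, ev 1] ++ if withQ then [qv 1] else []) ::
    (List.range (t-1)).flatMap fun j =>
      [(false, [xvv (j+1)]),
       (true, [dv (j+2), ev (j+2)] ++ if withQ then [qv (j+2)] else [])]) ++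
  [(false, [xvv t]), (true, (List.range t).map fun i => fv (i+1))]

def fNegs (t : ℕ) : List Lit := (List.range t).map fun i => Lit.neg (fv (i+1))

def psiMatrix (t : ℕ) : Finset Clause :=
  ({({Lit.neg (dv 0)} : Clause),
    ({Lit.pos (dv 0), Lit.neg (dv 1), Lit.neg (ev 1)} : Clause),
    (((Lit.pos (dv t) :: Lit.neg (xvv t) :: fNegs t).toFinset : Clause)),
    (((Lit.pos (ev t) :: Lit.pos (xvv t) :: fNegs t).toFinset : Clause))} : Finset Clause) ∪
  ((List.range (t-1)).flatMap fun j =>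
     [({Lit.pos (dv (j+1)), Lit.neg (xvv (j+1)), Lit.neg (dv (j+2)), Lit.neg (ev (j+2))} : Clause),
      ({Lit.pos (ev (j+1)), Lit.pos (xvv (j+1)), Lit.neg (dv (j+2)), Lit.neg (ev (j+2))} : Clause)]).toFinset ∪
  ((List.range t).flatMap fun j =>
     [({Lit.neg (xvv (j+1)), Lit.pos (fv (j+1))} : Clause),
      ({Lit.pos (xvv (j+1)), Lit.pos (fv (j+1))} : Clause)]).toFinset

def PsiF (t : ℕ) : PCNF := ⟨psiPrefix t false, psiMatrix t⟩

/-- Ψ_t with the extension variables q_i added to the prefix. -/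
def PsiFq (t : ℕ) : PCNF := ⟨psiPrefix t true, psiMatrix t⟩

/-- The extension clauses Δ: clausal form of q_i ↔ (¬d_i ∧ e_i), 1 ≤ i ≤ t. -/
def DeltaT (t : ℕ) : Finset Clause :=
  ((List.range t).flatMap fun i =>
    [({Lit.pos (qv (i+1)), Lit.pos (dv (i+1)), Lit.neg (ev (i+1))} : Clause),
     ({Lit.neg (qv (i+1)), Lit.neg (dv (i+1))} : Clause),
     ({Lit.neg (qv (i+1)), Lit.pos (ev (i+1))} : Clause)]).toFinset

/-- σ_{v,t} = { x_i ↦ q_i : 1 ≤ i ≤ t }. -/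
def sigmaQv (t : ℕ) : ℕ → Option ℕ := fun v =>
  if v % 5 = 2 ∧ 1 ≤ v / 5 ∧ v / 5 ≤ t then some (5 * (v / 5) + 4) else none

/-- σ_{v,t} = { x_i ↦ e_i : 1 ≤ i ≤ t }. -/
def sigmaEv (t : ℕ) : ℕ → Option ℕ := fun v =>
  if v % 5 = 2 ∧ 1 ≤ v / 5 ∧ v / 5 ≤ t then some (5 * (v / 5) + 1) else none

section Core

open Finset

/-- pigeons left out by an assignment (extending `σ0` on `D`) falsifying `c` -/
noncomputable def coreW {N : ℕ} {ι A : Type} (last : Fin N)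
    (Fls : ι → Equiv.Perm (Fin N) → A → Prop)
    (σ0 : Equiv.Perm (Fin N)) (D : Finset (Fin N)) (c : ι) : Finset (Fin N) :=
  open Classical in
  univ.filter fun i => ∃ σ a, (∀ d ∈ D, σ d = σ0 d) ∧ σ i = last ∧ Fls c σ a

/-- monotone pairs of `c` that are untouched by the restriction -/
def coreR {N : ℕ} (Mc : Finset (Fin N × Fin N))
    (σ0 : Equiv.Perm (Fin N)) (D : Finset (Fin N)) : Finset (Fin N × Fin N) :=
  Mc.filter fun p => p.1 ∉ D ∧ ∀ d ∈ D, σ0 d ≠ p.2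

theorem core_width {N : ℕ} {ι A : Type} (last : Fin N)
    (Fls : ι → Equiv.Perm (Fin N) → A → Prop) [Inhabited A] [Inhabited ι]
    (M : ι → Finset (Fin N × Fin N))
    (hswap : ∀ c σ a i k, i ≠ k → σ i = last → Fls c σ a →
      ¬ Fls c (σ * Equiv.swap i k) a → (i, σ k) ∈ M c)
    (π : List ι)
    (hstep : ∀ t < π.length, (∃ i, ∀ σ a, Fls π[t]! σ a → σ i = last) ∨
      ∃ s₁ < t, ∃ s₂ < t, ∀ σ a, Fls π[t]! σ a → ∃ a', Fls π[s₁]! σ a' ∨ Fls π[s₂]! σ a')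
    (hend : ∃ t < π.length, ∀ σ a, Fls π[t]! σ a)
    (σ0 : Equiv.Perm (Fin N)) (D : Finset (Fin N)) (hD : ∀ d ∈ D, σ0 d ≠ last)
    (hm : D.card + 3 ≤ N) :
    ∃ t < π.length, (coreW last Fls σ0 D π[t]!).Nonempty ∧
      2 * (N - D.card) ^ 2 ≤ 9 * (coreR (M π[t]!) σ0 D).card := by
  classical
  set W := coreW last Fls σ0 D with hW
  set m := N - D.card with hmdef
  have memW : ∀ c i, i ∈ W c ↔ ∃ σ a, (∀ d ∈ D, σ d = σ0 d) ∧ σ i = last ∧ Fls c σ a := by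
    intro c i; simp [hW, coreW]
  have hbig : ∃ t, t < π.length ∧ m < 3 * (W π[t]!).card := by
    obtain ⟨t, ht, h⟩ := hend
    refine ⟨t, ht, ?_⟩
    have : Dᶜ ⊆ W π[t]! := by
      intro i hi
      rw [memW]
      refine ⟨Equiv.swap (σ0 i) last * σ0, default, ?_, by simp, h _ _⟩
      intro d hd
      simp only [Equiv.Perm.coe_mul, Function.comp_apply]
      apply Equiv.swap_apply_of_ne_of_ne
      · intro e
        have := σ0.injective e
        subst this
        simp at hi; exact hi hd
      · exact hD d hd
    have h2 := card_le_card this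
    rw [card_compl, Fintype.card_fin] at h2
    omega
  obtain ⟨ht, hbt⟩ := Nat.find_spec hbig
  have hmin := fun s (hs : s < Nat.find hbig) => Nat.find_min hbig hs
  set t := Nat.find hbig with htdef
  have hup : 3 * (W π[t]!).card ≤ 2 * m := by
    rcases hstep t ht with ⟨i, hi⟩ | ⟨s₁, h₁, s₂, h₂, h⟩
    · have : (W π[t]!).card ≤ 1 := by
        have hsub : W π[t]! ⊆ {i} := by
          intro j hj
          rw [memW] at hj
          obtain ⟨σ, a, -, hl, hf⟩ := hj
          have := hi σ a hf
          simp only [mem_singleton]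
          exact σ.injective (hl.trans this.symm)
        simpa using card_le_card hsub
      omega
    · have hsub : W π[t]! ⊆ W π[s₁]! ∪ W π[s₂]! := by
        intro j hj
        rw [memW] at hj
        obtain ⟨σ, a, hd, hl, hf⟩ := hj
        obtain ⟨a', hf' | hf'⟩ := h σ a hf
        · exact mem_union_left _ ((memW _ _).2 ⟨σ, a', hd, hl, hf'⟩)
        · exact mem_union_right _ ((memW _ _).2 ⟨σ, a', hd, hl, hf'⟩)
      have h3 := (card_le_card hsub).trans (card_union_le _ _)
      have h4 := hmin s₁ h₁
      have h5 := hmin s₂ h₂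
      push Not at h4 h5
      have h4 := h4 (by omega)
      have h5 := h5 (by omega)
      omega
  refine ⟨t, ht, card_pos.1 (by omega), ?_⟩
  set c := π[t]! with hc
  have hWD : W c ⊆ Dᶜ := by
    intro i hi
    rw [memW] at hi
    obtain ⟨σ, a, hd, hl, -⟩ := hi
    rw [mem_compl]
    intro hiD
    exact hD i hiD ((hd i hiD).symm.trans hl)
  have hcardD : (Dᶜ \ W c).card = m - (W c).card := by
    rw [card_sdiff_of_subset hWD, card_compl, Fintype.card_fin]
  have key : ∀ i ∈ W c, m - (W c).card ≤ ((coreR (M c) σ0 D).filter fun p => p.1 = i).card := by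
    intro i hi
    have hi' := hi
    rw [memW] at hi
    obtain ⟨σ, a, hd, hl, hf⟩ := hi
    rw [← hcardD]
    apply card_le_card_of_injOn (fun k => (i, σ k))
    · intro k hk
      simp only [coe_sdiff, coe_compl, Set.mem_sdiff, Set.mem_compl_iff, mem_coe] at hk
      have hik : i ≠ k := by rintro rfl; exact hk.2 hi'
      have hiD : i ∉ D := by have := hWD hi'; simpa using this
      simp only [coreR, coe_filter, Set.mem_ofPred_eq, mem_filter, and_true]
      refine ⟨hswap c σ a i k hik hl hf ?_, hiD, ?_⟩
      · intro hf2
        apply hk.2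
        rw [memW]
        refine ⟨σ * Equiv.swap i k, a, ?_, by simp [hl], hf2⟩
        intro d hdD
        rw [Equiv.Perm.mul_apply, Equiv.swap_apply_of_ne_of_ne]
        · exact hd d hdD
        · rintro rfl; exact hiD hdD
        · rintro rfl; exact hk.1 hdD
      · intro d hdD e
        rw [← hd d hdD] at e
        have := σ.injective e
        subst this
        exact hk.1 hdD
    · intro k _ k' _ h
      simp only [Prod.mk.injEq, true_and] at h
      exact σ.injective h
  have hsum : (W c).card * (m - (W c).card) ≤ (coreR (M c) σ0 D).card := by
    have h1 : ∑ i ∈ W c, ((coreR (M c) σ0 D).filter fun p => p.1 = i).card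
        ≤ (coreR (M c) σ0 D).card := by
      rw [← card_biUnion]
      · apply card_le_card
        intro p hp
        simp only [mem_biUnion, mem_filter] at hp
        obtain ⟨_, _, h, _⟩ := hp
        exact h
      · intro i _ j _ hij
        rw [Function.onFun, disjoint_left]
        intro p hp hp'
        simp only [mem_filter] at hp hp'
        exact hij (hp.2.symm.trans hp'.2)
    refine le_trans ?_ h1
    rw [← smul_eq_mul]
    exact card_nsmul_le_sum _ _ _ key
  obtain ⟨r, hr⟩ : ∃ r, m = (W c).card + r := ⟨m - (W c).card, by omega⟩
  rw [hr] at hbt hup ⊢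
  rw [hr] at hsum
  have e : (W c).card + r - (W c).card = r := by omega
  rw [e] at hsum
  set w := (W c).card
  have : 2 * (w + r) ^ 2 ≤ 9 * (w * r) := by
    have a1 : w ≤ 2 * r := by omega
    have a2 : r ≤ 2 * w := by omega
    obtain ⟨u, hu⟩ := Nat.exists_eq_add_of_le a1
    obtain ⟨v, hv⟩ := Nat.exists_eq_add_of_le a2
    zify at *
    nlinarith [mul_nonneg (sub_nonneg.2 a1) (sub_nonneg.2 a2)]
  omega

/-- large, not yet killed members -/
noncomputable def coreAlive {N : ℕ} {ι : Type} (M : ι → Finset (Fin N × Fin N)) (F : Finset ι)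
    (σ0 : Equiv.Perm (Fin N)) (D : Finset (Fin N)) : Finset ι :=
  open Classical in
  F.filter fun c => (∀ d ∈ D, (d, σ0 d) ∉ M c) ∧ N ^ 2 ≤ 18 * (coreR (M c) σ0 D).card

theorem core_greedy {N : ℕ} {ι : Type} (last : Fin N)
    (M : ι → Finset (Fin N × Fin N)) (hM : ∀ c p, p ∈ M c → p.2 ≠ last) (F : Finset ι) (k : ℕ) :
    ∃ (σ0 : Equiv.Perm (Fin N)) (D : Finset (Fin N)), D.card ≤ k ∧ (∀ d ∈ D, σ0 d ≠ last) ∧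
      (coreAlive M F σ0 D).card * 18 ^ k ≤ F.card * 17 ^ k := by
  classical
  induction k with
  | zero =>
    refine ⟨1, ∅, by simp, by simp, ?_⟩
    simp only [pow_zero, mul_one]
    exact card_le_card (filter_subset _ _)
  | succ k ih =>
    obtain ⟨σ0, D, hDk, hD, hle⟩ := ih
    set L := coreAlive M F σ0 D with hL
    rcases L.eq_empty_or_nonempty with hE | hne
    · refine ⟨σ0, D, by omega, hD, ?_⟩
      rw [← hL, hE]; simp
    have hN : 0 < N := last.pos
    -- averaging
    have hav : ∃ p : Fin N × Fin N, L.card ≤ 18 * (L.filter fun c => p ∈ coreR (M c) σ0 D).card := by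
      by_contra hcon
      push Not at hcon
      have h1 : ∑ p : Fin N × Fin N, 18 * (L.filter fun c => p ∈ coreR (M c) σ0 D).card
          < ∑ p : Fin N × Fin N, L.card := by
        apply sum_lt_sum_of_nonempty
        · exact ⟨(last, last), mem_univ _⟩
        · intro p _; exact hcon p
      have h2 : ∑ p : Fin N × Fin N, (L.filter fun c => p ∈ coreR (M c) σ0 D).card
          = ∑ c ∈ L, (coreR (M c) σ0 D).card := by
        simp only [card_filter]
        rw [sum_comm]
        apply sum_congr rfl
        intro c _
        rw [← card_filter]
        congr 1
        ext p; simp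
      rw [← mul_sum, h2] at h1
      have h3 : ∑ c ∈ L, N ^ 2 ≤ ∑ c ∈ L, 18 * (coreR (M c) σ0 D).card := by
        apply sum_le_sum
        intro c hc
        rw [hL, coreAlive, mem_filter] at hc
        exact hc.2.2
      rw [← mul_sum] at h3
      simp only [sum_const, smul_eq_mul, card_univ, Fintype.card_prod, Fintype.card_fin] at h1 h3
      nlinarith
    obtain ⟨⟨i, j⟩, hp⟩ := hav
    have hpos : (L.filter fun c => (i, j) ∈ coreR (M c) σ0 D).Nonempty := by
      rw [← card_pos]
      have := card_pos.2 hne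
      omega
    obtain ⟨c0, hc0⟩ := hpos
    simp only [coreR, mem_filter] at hc0
    obtain ⟨-, hc0M, hiD, hjD⟩ := hc0
    have hjl := hM _ _ hc0M
    simp only at hjl
    set σ1 := Equiv.swap (σ0 i) j * σ0 with hσ1
    have hσi : σ1 i = j := by simp [hσ1]
    have hσd : ∀ d ∈ D, σ1 d = σ0 d := by
      intro d hd
      rw [hσ1, Equiv.Perm.mul_apply, Equiv.swap_apply_of_ne_of_ne]
      · intro e
        have := σ0.injective e
        subst this; exact hiD hd
      · exact hjD d hd
    refine ⟨σ1, insert i D, ?_, ?_, ?_⟩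
    · exact (card_insert_le _ _).trans (by omega)
    · intro d hd
      rw [mem_insert] at hd
      rcases hd with rfl | hd
      · rw [hσi]; exact hjl
      · rw [hσd d hd]; exact hD d hd
    · have hsub : coreAlive M F σ1 (insert i D) ⊆ L \ (L.filter fun c => (i, j) ∈ coreR (M c) σ0 D) := by
        intro c hc
        rw [coreAlive, mem_filter] at hc
        obtain ⟨hcF, hk, hc⟩ := hc
        have hRsub : coreR (M c) σ1 (insert i D) ⊆ coreR (M c) σ0 D := by
          intro p hp
          simp only [coreR, mem_filter, mem_insert, not_or, forall_eq_or_imp] at hp ⊢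
          refine ⟨hp.1, hp.2.1.2, ?_⟩
          intro d hd
          rw [← hσd d hd]
          exact hp.2.2.2 d hd
        rw [mem_sdiff]
        constructor
        · rw [hL, coreAlive, mem_filter]
          refine ⟨hcF, ?_, hc.trans (Nat.mul_le_mul_left _ (card_le_card hRsub))⟩
          intro d hd
          rw [← hσd d hd]
          exact hk d (mem_insert_of_mem hd)
        · intro hcm
          simp only [coreR, mem_filter] at hcm
          have := hk i (mem_insert_self _ _)
          rw [hσi] at this
          exact this hcm.2.1
      have h1 := card_le_card hsub
      rw [card_sdiff_of_subset (filter_subset _ _)] at h1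
      have h2 : 18 * (coreAlive M F σ1 (insert i D)).card ≤ 17 * L.card := by omega
      calc (coreAlive M F σ1 (insert i D)).card * 18 ^ (k+1)
          = (18 * (coreAlive M F σ1 (insert i D)).card) * 18 ^ k := by ring
        _ ≤ (17 * L.card) * 18 ^ k := Nat.mul_le_mul_right _ h2
        _ = 17 * (L.card * 18 ^ k) := by ring
        _ ≤ 17 * (F.card * 17 ^ k) := Nat.mul_le_mul_left _ hle
        _ = F.card * 17 ^ (k+1) := by ring

theorem core_main {N : ℕ} {ι A : Type} (last : Fin N)
    (Fls : ι → Equiv.Perm (Fin N) → A → Prop) [Inhabited A] [Inhabited ι]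
    (M : ι → Finset (Fin N × Fin N)) (hM : ∀ c p, p ∈ M c → p.2 ≠ last)
    (hswap : ∀ c σ a i k, i ≠ k → σ i = last → Fls c σ a →
      ¬ Fls c (σ * Equiv.swap i k) a → (i, σ k) ∈ M c)
    (hkill : ∀ c σ a i, (i, σ i) ∈ M c → ¬ Fls c σ a)
    (π : List ι)
    (hstep : ∀ t < π.length, (∃ i, ∀ σ a, Fls π[t]! σ a → σ i = last) ∨
      ∃ s₁ < t, ∃ s₂ < t, ∀ σ a, Fls π[t]! σ a → ∃ a', Fls π[s₁]! σ a' ∨ Fls π[s₂]! σ a')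
    (hend : ∃ t < π.length, ∀ σ a, Fls π[t]! σ a)
    (hN : 6 ≤ N) (F : Finset ι) (hF : ∀ c ∈ π, (M c).Nonempty → c ∈ F) :
    18 ^ (N / 2) ≤ F.card * 17 ^ (N / 2) := by
  classical
  by_contra hlt
  push Not at hlt
  obtain ⟨σ0, D, hDk, hD, hle⟩ := core_greedy last M hM F (N / 2)
  have hal : (coreAlive M F σ0 D).card = 0 := by
    by_contra h
    have : 1 * 18 ^ (N/2) ≤ (coreAlive M F σ0 D).card * 18 ^ (N/2) :=
      Nat.mul_le_mul_right _ (Nat.one_le_iff_ne_zero.2 h)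
    omega
  rw [card_eq_zero] at hal
  obtain ⟨t, ht, ⟨i, hi⟩, hw⟩ := core_width last Fls M hswap π hstep hend σ0 D hD (by omega)
  have hmem : π[t]! ∈ π := by
    rw [getElem!_pos π t ht]; exact List.getElem_mem ht
  have hlarge : N ^ 2 ≤ 18 * (coreR (M π[t]!) σ0 D).card := by
    have : N ≤ 2 * (N - D.card) := by omega
    have h2 : N ^ 2 ≤ (2 * (N - D.card)) ^ 2 := Nat.pow_le_pow_left this 2
    rw [mul_pow] at h2
    omega
  have hne : (M π[t]!).Nonempty := by
    have : 0 < (coreR (M π[t]!) σ0 D).card := by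
      have : 0 < N ^ 2 := by positivity
      omega
    obtain ⟨p, hp⟩ := card_pos.1 this
    rw [coreR, mem_filter] at hp
    exact ⟨p, hp.1⟩
  have : π[t]! ∈ coreAlive M F σ0 D := by
    rw [coreAlive, mem_filter]
    refine ⟨hF _ hmem hne, ?_, hlarge⟩
    intro d hd hdm
    simp only [coreW, mem_filter] at hi
    obtain ⟨-, σ, a, hag, -, hf⟩ := hi
    rw [← hag d hd] at hdm
    exact hkill _ _ _ _ hdm hf
  rw [hal] at this
  simp at this

end Core

section Application

theorem xv_inj {i j i' j' : ℕ} : xv i j = xv i' j' ↔ i = i' ∧ j = j' := by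
  simp [xv, Nat.pair_eq_pair]
theorem yv_inj {i j i' j' : ℕ} : yv i j = yv i' j' ↔ i = i' ∧ j = j' := by
  simp [yv, Nat.pair_eq_pair]
theorem zv_inj {i j k i' j' k' : ℕ} : zv i j k = zv i' j' k' ↔ i = i' ∧ j = j' ∧ k = k' := by
  simp [zv, Nat.pair_eq_pair]
theorem xv_ne_yv {i j i' j' : ℕ} : xv i j ≠ yv i' j' := by
  simp [xv, yv, Nat.pair_eq_pair]
theorem xv_ne_zv {i j i' j' k' : ℕ} : xv i j ≠ zv i' j' k' := by
  simp [xv, zv, Nat.pair_eq_pair]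
theorem yv_ne_zv {i j i' j' k' : ℕ} : yv i j ≠ zv i' j' k' := by
  simp [yv, zv, Nat.pair_eq_pair]

theorem mem_Xlist {n x : ℕ} : x ∈ Xlist n ↔ ∃ i < n + 1, ∃ j < n, x = xv (i+1) (j+1) := by
  simp only [Xlist, List.mem_flatMap, List.mem_range, List.mem_map, eq_comm]
theorem mem_Ylist {n x : ℕ} : x ∈ Ylist n ↔ ∃ i < n + 1, ∃ j < n, x = yv (i+1) (j+1) := by
  simp only [Ylist, List.mem_flatMap, List.mem_range, List.mem_map, eq_comm]
theorem mem_Zlist {n x : ℕ} : x ∈ Zlist n ↔ (∃ i < n + 1, x = zv (i+1) 0 0) ∨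
    ∃ j < n, ∃ i₁ < n + 1, ∃ i₂ < n + 1, i₁ < i₂ ∧ x = zv (i₁+1) (i₂+1) (j+1) := by
  simp only [Zlist, List.mem_append, List.mem_flatMap, List.mem_range, List.mem_map,
    List.mem_filterMap, Option.ite_none_right_eq_some, Option.some.injEq]
  simp only [eq_comm]

structure GoodF (Φ : PCNF) (n : ℕ) : Prop where
  mat : Φ.matrix = phiMatrix n
  exX : ∀ x ∈ Xlist n, Φ.existB x = true
  exZ : ∀ x ∈ Zlist n, Φ.existB x = true
  unY : ∀ x ∈ Ylist n, Φ.univB x = true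
  lvYZ : ∀ y ∈ Ylist n, ∀ z ∈ Zlist n, Φ.lv y < Φ.lv z

theorem X_not_Y {n x : ℕ} (h : x ∈ Xlist n) : x ∉ Ylist n := by
  rw [mem_Xlist] at h; rw [mem_Ylist]
  obtain ⟨i, _, j, _, rfl⟩ := h
  rintro ⟨i', _, j', _, h⟩
  exact xv_ne_yv h

theorem Z_not_Y {n x : ℕ} (h : x ∈ Zlist n) : x ∉ Ylist n := by
  rw [mem_Zlist] at h; rw [mem_Ylist]
  rintro ⟨i', _, j', _, rfl⟩
  rcases h with ⟨i, _, h⟩ | ⟨j, _, i, _, k, _, _, h⟩ <;> exact yv_ne_zv h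

theorem Z_not_X {n x : ℕ} (h : x ∈ Zlist n) : x ∉ Xlist n := by
  rw [mem_Zlist] at h; rw [mem_Xlist]
  rintro ⟨i', _, j', _, rfl⟩
  rcases h with ⟨i, _, h⟩ | ⟨j, _, i, _, k, _, _, h⟩ <;> exact xv_ne_zv h

theorem good_Phi (n : ℕ) : GoodF (PhiF n) n where
  mat := rfl
  exX x hx := by simp [PCNF.existB, PhiF, hx]
  exZ x hx := by simp [PCNF.existB, PhiF, hx]
  unY x hx := by simp [PCNF.univB, PhiF, hx]
  lvYZ y hy z hz := by
    have h1 : y ∉ Xlist n := fun h => X_not_Y h hy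
    have h2 := Z_not_X hz
    have h3 := Z_not_Y hz
    simp [PCNF.lv, PhiF, List.findIdx_cons, hy, hz, h1, h2, h3]

theorem good_Omega (n : ℕ) : GoodF (OmegaF n) n where
  mat := rfl
  exX x hx := by simp [PCNF.existB, OmegaF, hx]
  exZ x hx := by simp [PCNF.existB, OmegaF, hx]
  unY x hx := by simp [PCNF.univB, OmegaF, hx]
  lvYZ y hy z hz := by
    have h3 := Z_not_Y hz
    simp [PCNF.lv, OmegaF, List.findIdx_cons, hy, hz, h3]

/-- completion of an annotation by a total assignment -/
def annExt (τ : Ann) (α : ℕ → Bool) : ℕ → Bool := fun u =>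
  if (u, true) ∈ τ then true else if (u, false) ∈ τ then false else α u

/-- value of an existential variable: `X` by the critical assignment `σ`, `Z` by Skolem functions -/
def valF (n : ℕ) (σ : Equiv.Perm (Fin (n+1))) (β : ℕ → Bool) (x : ℕ) : Prop :=
  (∃ i j : Fin (n+1), j ≠ Fin.last n ∧ x = xv (i.1+1) (j.1+1) ∧ σ i = j) ∨
  (∃ i < n + 1, ∃ j < n, x = zv (i+1) 0 0 ∧ β (yv (i+1) (j+1)) = true) ∨
  (∃ j < n, ∃ i₁ < n + 1, ∃ i₂ < n + 1, i₁ < i₂ ∧ x = zv (i₁+1) (i₂+1) (j+1) ∧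
    ¬ (β (yv (i₁+1) (j+1)) = true ∧ β (yv (i₂+1) (j+1)) = true))

theorem valF_congr {n : ℕ} {σ : Equiv.Perm (Fin (n+1))} {β β' : ℕ → Bool} {x : ℕ}
    (h : x ∈ Zlist n → ∀ y ∈ Ylist n, β y = β' y) : valF n σ β x ↔ valF n σ β' x := by
  by_cases hx : x ∈ Zlist n
  · have h := h hx
    have hy : ∀ i < n + 1, ∀ j < n, β (yv (i+1) (j+1)) = β' (yv (i+1) (j+1)) :=
      fun i hi j hj => h _ (mem_Ylist.2 ⟨i, hi, j, hj, rfl⟩)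
    unfold valF
    refine or_congr Iff.rfl (or_congr ?_ ?_)
    · constructor
      · rintro ⟨i, hi, j, hj, e, hb⟩
        exact ⟨i, hi, j, hj, e, by rw [← hy i hi j hj]; exact hb⟩
      · rintro ⟨i, hi, j, hj, e, hb⟩
        exact ⟨i, hi, j, hj, e, by rw [hy i hi j hj]; exact hb⟩
    · constructor
      · rintro ⟨j, hj, i, hi, k, hk, l, e, hb⟩
        exact ⟨j, hj, i, hi, k, hk, l, e, by rw [← hy i hi j hj, ← hy k hk j hj]; exact hb⟩
      · rintro ⟨j, hj, i, hi, k, hk, l, e, hb⟩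
        exact ⟨j, hj, i, hi, k, hk, l, e, by rw [hy i hi j hj, hy k hk j hj]; exact hb⟩
  · have h2 : ∀ γ : ℕ → Bool, valF n σ γ x ↔
        (∃ i j : Fin (n+1), j ≠ Fin.last n ∧ x = xv (i.1+1) (j.1+1) ∧ σ i = j) := by
      intro γ
      constructor
      · rintro (h | ⟨i, hi, j, hj, e, -⟩ | ⟨j, hj, i, hi, k, hk, l, e, -⟩)
        · exact h
        · exact absurd (mem_Zlist.2 (Or.inl ⟨i, hi, e⟩)) hx
        · exact absurd (mem_Zlist.2 (Or.inr ⟨j, hj, i, hi, k, hk, l, e⟩)) hx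
      · exact Or.inl
    rw [h2, h2]

def litT (n : ℕ) (σ : Equiv.Perm (Fin (n+1))) (β : ℕ → Bool) : Lit → Prop
  | .pos x => valF n σ β x
  | .neg x => ¬ valF n σ β x

theorem litT_congr {n : ℕ} {σ : Equiv.Perm (Fin (n+1))} {β β' : ℕ → Bool} {l : Lit}
    (h : l.var ∈ Zlist n → ∀ y ∈ Ylist n, β y = β' y) : litT n σ β l ↔ litT n σ β' l := by
  cases l with
  | pos x => exact valF_congr h
  | neg x => exact not_congr (valF_congr h)

def FalsA (n : ℕ) (A : AClause) (σ : Equiv.Perm (Fin (n+1))) (α : ℕ → Bool) : Prop :=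
  ∀ al ∈ A, ¬ litT n σ (annExt al.ann α) al.lit

noncomputable def MonA (n : ℕ) (A : AClause) : Finset (Fin (n+1) × Fin (n+1)) :=
  open Classical in
  Finset.univ.filter fun p => p.2 ≠ Fin.last n ∧
    ((∃ τ, (⟨Lit.pos (xv (p.1.1+1) (p.2.1+1)), τ⟩ : ALit) ∈ A) ∨
      ∃ i' : Fin (n+1), i' ≠ p.1 ∧ ∃ τ, (⟨Lit.neg (xv (i'.1+1) (p.2.1+1)), τ⟩ : ALit) ∈ A)

theorem valF_xv {n : ℕ} {σ : Equiv.Perm (Fin (n+1))} {β : ℕ → Bool} {i j : Fin (n+1)}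
    (hj : j ≠ Fin.last n) : valF n σ β (xv (i.1+1) (j.1+1)) ↔ σ i = j := by
  constructor
  · rintro (⟨i', j', _, e, h⟩ | ⟨i, hi, j, hj, e, -⟩ | ⟨j, hj, i, hi, k, hk, l, e, -⟩)
    · rw [xv_inj] at e
      have e1 : i = i' := Fin.ext (by omega)
      have e2 : j = j' := Fin.ext (by omega)
      rw [e1, e2, h]
    · exact absurd e xv_ne_zv
    · exact absurd e xv_ne_zv
  · intro h
    exact Or.inl ⟨i, j, hj, rfl, h⟩

theorem app_kill (n : ℕ) (A : AClause) (σ : Equiv.Perm (Fin (n+1))) (α : ℕ → Bool)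
    (i : Fin (n+1)) (h : (i, σ i) ∈ MonA n A) : ¬ FalsA n A σ α := by
  intro hf
  simp only [MonA, Finset.mem_filter, Finset.mem_univ, true_and] at h
  obtain ⟨hl, ⟨τ, h⟩ | ⟨i', hi', τ, h⟩⟩ := h
  · exact hf _ h ((valF_xv hl).2 rfl)
  · refine hf _ h ?_
    intro hv
    rw [valF_xv hl] at hv
    exact hi' (σ.injective hv)

theorem app_swap (n : ℕ) (A : AClause) (σ : Equiv.Perm (Fin (n+1))) (α : ℕ → Bool)
    (i k : Fin (n+1)) (hik : i ≠ k) (hl : σ i = Fin.last n) (hf : FalsA n A σ α)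
    (hf' : ¬ FalsA n A (σ * Equiv.swap i k) α) : (i, σ k) ∈ MonA n A := by
  have hkl : σ k ≠ Fin.last n := by
    rw [← hl]; intro e; exact hik (σ.injective e).symm
  simp only [MonA, Finset.mem_filter, Finset.mem_univ, true_and]
  refine ⟨hkl, ?_⟩
  unfold FalsA at hf'
  push Not at hf'
  obtain ⟨⟨l, τ⟩, hal, ht⟩ := hf'
  have hnt := hf _ hal
  cases l with
  | pos x =>
    left
    simp only [litT] at ht hnt
    rcases ht with ⟨a, b, hb, e, hab⟩ | h
    · subst e
      rw [valF_xv hb] at hnt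
      rw [Equiv.Perm.mul_apply] at hab
      by_cases h1 : a = i
      · subst h1
        rw [Equiv.swap_apply_left] at hab
        subst hab
        exact ⟨τ, hal⟩
      · by_cases h2 : a = k
        · subst h2
          rw [Equiv.swap_apply_right, hl] at hab
          exact absurd hab.symm hb
        · rw [Equiv.swap_apply_of_ne_of_ne h1 h2] at hab
          exact absurd hab hnt
    · exact absurd (Or.inr h) hnt
  | neg x =>
    right
    simp only [litT, not_not] at ht hnt
    rcases hnt with ⟨a, b, hb, e, hab⟩ | h
    · subst e
      rw [valF_xv hb] at ht
      rw [Equiv.Perm.mul_apply] at ht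
      by_cases h1 : a = i
      · subst h1
        exact absurd (hab.symm.trans hl) hb
      · by_cases h2 : a = k
        · subst h2
          subst hab
          exact ⟨a, fun e => hik e.symm, τ, hal⟩
        · rw [Equiv.swap_apply_of_ne_of_ne h1 h2] at ht
          exact absurd hab ht
    · exact absurd (Or.inr h) ht

theorem mem_annCompl {μ τ : Ann} {u : ℕ} {b : Bool} :
    (u, b) ∈ annCompl μ τ ↔ (u, b) ∈ μ ∨ ((u, b) ∈ τ ∧ (u, true) ∉ μ ∧ (u, false) ∉ μ) := by
  simp [annCompl]
  tauto

theorem annExt_compl (μ τ : Ann) (α : ℕ → Bool) (u : ℕ) :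
    annExt (annCompl μ τ) α u = annExt μ (annExt τ α) u := by
  unfold annExt
  simp only [mem_annCompl]
  by_cases h1 : (u, true) ∈ μ <;> by_cases h2 : (u, false) ∈ μ <;> simp [h1, h2]

theorem annExt_restr {Φ : PCNF} {n : ℕ} (hG : GoodF Φ n) (σ : Ann) (l : Lit) (α : ℕ → Bool)
    (hl : l.var ∈ Zlist n) (y : ℕ) (hy : y ∈ Ylist n) :
    annExt (annRestr Φ σ l) α y = annExt σ α y := by
  have := hG.lvYZ y hy _ hl
  simp [annExt, annRestr, this]

theorem applySigv_noSub (C : Clause) : C.applySigv noSub = C := by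
  have : _root_.applySigv noSub = id := by
    funext l; cases l <;> rfl
  simp [Clause.applySigv, this]

theorem mem_axAnn_true {Φ : PCNF} {C : Clause} {u : ℕ} :
    (u, true) ∈ axAnn Φ C ↔ Lit.neg u ∈ C ∧ Φ.univB u = true := by
  simp only [axAnn, Finset.mem_image, Finset.mem_filter]
  constructor
  · rintro ⟨l, ⟨h1, h2⟩, h3⟩
    cases l with
    | pos x => simp at h3
    | neg x => simp at h3; subst h3; exact ⟨h1, h2⟩
  · rintro ⟨h1, h2⟩
    exact ⟨_, ⟨h1, h2⟩, rfl⟩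

theorem mem_axAnn_false {Φ : PCNF} {C : Clause} {u : ℕ} :
    (u, false) ∈ axAnn Φ C ↔ Lit.pos u ∈ C ∧ Φ.univB u = true := by
  simp only [axAnn, Finset.mem_image, Finset.mem_filter]
  constructor
  · rintro ⟨l, ⟨h1, h2⟩, h3⟩
    cases l with
    | neg x => simp at h3
    | pos x => simp at h3; subst h3; exact ⟨h1, h2⟩
  · rintro ⟨h1, h2⟩
    exact ⟨_, ⟨h1, h2⟩, rfl⟩

/-- if the annotated matrix clause is falsified, then all existential literals of `C` are false under the
completed universal assignment -/
theorem fals_ax {Φ : PCNF} {n : ℕ} (hG : GoodF Φ n) {C : Clause} {σ : Equiv.Perm (Fin (n+1))}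
    {α : ℕ → Bool} (hf : FalsA n (axClause Φ C) σ α) (l : Lit) (hl : l ∈ C)
    (hex : Φ.existB l.var = true) : ¬ litT n σ (annExt (axAnn Φ C) α) l := by
  have := hf ⟨l, annRestr Φ (axAnn Φ C) l⟩ (by
    simp only [axClause, Finset.mem_image, Finset.mem_filter]
    exact ⟨l, ⟨hl, hex⟩, rfl⟩)
  rwa [litT_congr (β' := annExt (axAnn Φ C) α)] at this
  intro hz y hy
  exact annExt_restr hG _ _ _ hz y hy

theorem app_ax {Φ : PCNF} {n : ℕ} (hG : GoodF Φ n) (C : Clause) (hC : C ∈ Φ.matrix) :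
    ∃ i : Fin (n+1), ∀ σ α, FalsA n (axClause Φ C) σ α → σ i = Fin.last n := by
  rw [hG.mat] at hC
  simp only [phiMatrix, TPHPcls, PHPcls, Finset.mem_union, Finset.mem_singleton,
    List.mem_toFinset, List.mem_flatMap, List.mem_map, List.mem_range, List.mem_filterMap,
    Option.ite_none_right_eq_some, Option.some.injEq] at hC
  rcases hC with ((rfl | ⟨i, hi, j, hj, rfl⟩) | ⟨j, hj, i, hi, k, hk, hC⟩) |
    (⟨i, hi, rfl⟩ | ⟨j, hj, i, hi, k, hk, hik, rfl⟩)
  · -- all z negative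
    refine ⟨0, fun σ α hf => ?_⟩
    exfalso
    set C : Clause := ((Zlist n).map Lit.neg).toFinset with hCdef
    set β := annExt (axAnn Φ C) α
    have hz : ∀ z ∈ Zlist n, valF n σ β z := by
      intro z hz
      have := fals_ax hG hf (Lit.neg z) (by simp [hCdef, hz]) (hG.exZ z hz)
      simpa [litT, β] using this
    have h1 : ∀ i : Fin (n+1), ∃ j : Fin n, β (yv (i.1+1) (j.1+1)) = true := by
      intro i
      rcases hz (zv (i.1+1) 0 0) (mem_Zlist.2 (Or.inl ⟨i, i.2, rfl⟩)) with
        ⟨_, _, _, e, _⟩ | ⟨i', hi', j, hj, e, hb⟩ | ⟨_, _, _, _, _, _, _, e, _⟩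
      · exact absurd e.symm xv_ne_zv
      · rw [zv_inj] at e
        refine ⟨⟨j, hj⟩, ?_⟩
        have : i.1 = i' := by omega
        rw [this]; exact hb
      · rw [zv_inj] at e; omega
    choose f hfb using h1
    have h2 : ∀ a b : Fin (n+1), a < b → f a ≠ f b := by
      intro a b hab e
      rcases hz (zv (a.1+1) (b.1+1) ((f a).1+1))
        (mem_Zlist.2 (Or.inr ⟨(f a).1, (f a).2, a, a.2, b, b.2, hab, rfl⟩)) with
        ⟨_, _, _, e, _⟩ | ⟨i', hi', j, hj, e, hb⟩ | ⟨j, _, i', _, k', _, _, e', hb⟩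
      · exact absurd e.symm xv_ne_zv
      · rw [zv_inj] at e; omega
      · rw [zv_inj] at e'
        obtain ⟨e1, e2, e3⟩ := e'
        rw [← e1, ← e2, ← e3] at hb
        apply hb
        refine ⟨hfb a, ?_⟩
        rw [e]; exact hfb b
    obtain ⟨a, b, hab, e⟩ := Fintype.exists_ne_map_eq_of_card_lt f (by simp)
    rcases lt_or_gt_of_ne hab with h | h
    · exact h2 a b h e
    · exact h2 b a h e.symm
  · refine ⟨0, fun σ α hf => ?_⟩
    exfalso
    have hzm : zv (i+1) 0 0 ∈ Zlist n := mem_Zlist.2 (Or.inl ⟨i, hi, rfl⟩)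
    refine fals_ax hG hf (Lit.pos (zv (i+1) 0 0)) (by simp) (hG.exZ _ hzm) ?_
    refine Or.inr (Or.inl ⟨i, hi, j, hj, rfl, ?_⟩)
    have : (yv (i+1) (j+1), true) ∈ axAnn Φ {Lit.pos (zv (i+1) 0 0), Lit.neg (yv (i+1) (j+1))} :=
      mem_axAnn_true.2 ⟨by simp, hG.unY _ (mem_Ylist.2 ⟨i, hi, j, hj, rfl⟩)⟩
    simp [annExt, this]
  · split_ifs at hC with hik
    swap
    · simp at hC
    refine ⟨0, fun σ α hf => ?_⟩
    exfalso
    have hzm : zv (i+1) (k+1) (j+1) ∈ Zlist n :=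
      mem_Zlist.2 (Or.inr ⟨j, hj, i, hi, k, hk, hik, rfl⟩)
    have gen : ∀ a < n + 1, C = {Lit.pos (zv (i+1) (k+1) (j+1)), Lit.pos (yv (a+1) (j+1))} →
        annExt (axAnn Φ C) α (yv (a+1) (j+1)) = false := by
      intro a ha hCe
      have h1 : (yv (a+1) (j+1), false) ∈ axAnn Φ C :=
        mem_axAnn_false.2 ⟨by simp [hCe], hG.unY _ (mem_Ylist.2 ⟨a, ha, j, hj, rfl⟩)⟩
      have h2 : (yv (a+1) (j+1), true) ∉ axAnn Φ C := by
        rw [mem_axAnn_true]; simp [hCe]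
      simp [annExt, h1, h2]
    simp only [List.mem_cons, List.not_mem_nil, or_false] at hC
    refine fals_ax hG hf (Lit.pos (zv (i+1) (k+1) (j+1)))
      (by rcases hC with rfl | rfl <;> simp) (hG.exZ _ hzm) ?_
    refine Or.inr (Or.inr ⟨j, hj, i, hi, k, hk, hik, rfl, ?_⟩)
    rintro ⟨h1, h2⟩
    rcases hC with hC | hC
    · rw [gen i hi hC] at h1; cases h1
    · rw [gen k hk hC] at h2; cases h2
  · refine ⟨⟨i, hi⟩, fun σ α hf => ?_⟩
    by_contra hne
    have hlt : (σ ⟨i, hi⟩).1 < n := by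
      have h1 := (σ ⟨i, hi⟩).2
      have h2 : (σ ⟨i, hi⟩).1 ≠ n := fun e => hne (Fin.ext e)
      omega
    refine fals_ax hG hf (Lit.pos (xv (i+1) ((σ ⟨i, hi⟩).1+1))) ?_ ?_ ?_
    · simp only [List.mem_toFinset, List.mem_map, List.mem_range]
      exact ⟨_, hlt, rfl⟩
    · exact hG.exX _ (mem_Xlist.2 ⟨i, hi, _, hlt, rfl⟩)
    · exact (valF_xv (i := ⟨i, hi⟩) hne).2 rfl
  · refine ⟨0, fun σ α hf => ?_⟩
    exfalso
    have hjl : (⟨j, by omega⟩ : Fin (n+1)) ≠ Fin.last n := by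
      intro e; have := congrArg Fin.val e; simp at this; omega
    have h1 := fals_ax hG hf (Lit.neg (xv (i+1) (j+1))) (by simp)
      (hG.exX _ (mem_Xlist.2 ⟨i, hi, j, hj, rfl⟩))
    have h2 := fals_ax hG hf (Lit.neg (xv (k+1) (j+1))) (by simp)
      (hG.exX _ (mem_Xlist.2 ⟨k, hk, j, hj, rfl⟩))
    simp only [litT, not_not] at h1 h2
    rw [valF_xv (i := ⟨i, hi⟩) hjl] at h1
    rw [valF_xv (i := ⟨k, hk⟩) hjl] at h2
    have := σ.injective (h1.trans h2.symm)
    simp only [Fin.mk.injEq] at this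
    omega

theorem app_step {Φ : PCNF} {n : ℕ} (hG : GoodF Φ n) {prev : List AClause} {A : AClause}
    (h : IRStep Φ ∅ noSub prev A) :
    (∃ i : Fin (n+1), ∀ σ α, FalsA n A σ α → σ i = Fin.last n) ∨
    ∃ B₁ ∈ prev, ∃ B₂ ∈ prev, ∀ σ α, FalsA n A σ α → ∃ α', FalsA n B₁ σ α' ∨ FalsA n B₂ σ α' := by
  cases h with
  | ax C hC hnt hnt' =>
    left
    rw [applySigv_noSub]
    exact app_ax hG C hC
  | axExt C hC hnt => simp at hC
  | res x τ A B hA hB hxa hxb =>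
    right
    refine ⟨A, hA, B, hB, fun σ α hf => ⟨α, ?_⟩⟩
    by_cases hv : valF n σ (annExt τ α) x
    · right
      intro al hal
      by_cases he : al = ⟨Lit.neg x, τ⟩
      · subst he; simpa [litT] using hv
      · exact hf al (Finset.mem_union_right _ (Finset.mem_erase.2 ⟨he, hal⟩))
    · left
      intro al hal
      by_cases he : al = ⟨Lit.pos x, τ⟩
      · subst he; simpa [litT] using hv
      · exact hf al (Finset.mem_union_left _ (Finset.mem_erase.2 ⟨he, hal⟩))
  | fac A hA => exact Or.inr ⟨A, hA, A, hA, fun σ α hf => ⟨α, Or.inl hf⟩⟩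
  | inst A τ hA hfun hdom =>
    right
    refine ⟨A, hA, A, hA, fun σ α hf => ⟨annExt τ α, Or.inl ?_⟩⟩
    intro al hal
    have := hf _ (Finset.mem_image_of_mem _ hal)
    simp only at this
    rwa [litT_congr (β' := annExt al.ann (annExt τ α))] at this
    intro hz y hy
    rw [annExt_restr hG _ _ _ hz y hy, annExt_compl]

theorem card_le_aSize (π : List AClause) : (π.toFinset.erase ∅).card ≤ aSize π := by
  induction π with
  | nil => simp
  | cons A π ih =>
    have e : aSize (A :: π) = AClause.symSize A + aSize π := by simp [aSize]
    rw [e]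
    by_cases hA : A = ∅
    · subst hA
      rw [List.toFinset_cons]
      have : (insert (∅ : AClause) π.toFinset).erase ∅ = π.toFinset.erase ∅ := by
        ext x; simp
      rw [this]; omega
    · have h1 : 1 ≤ AClause.symSize A := by
        obtain ⟨al, hal⟩ := Finset.nonempty_iff_ne_empty.2 hA
        have : al.symSize ≤ AClause.symSize A :=
          Finset.single_le_sum (f := ALit.symSize) (fun _ _ => Nat.zero_le _) hal
        have : 1 ≤ al.symSize := by simp [ALit.symSize]
        omega
      rw [List.toFinset_cons, Finset.erase_insert_of_ne (by exact hA)]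
      have := Finset.card_insert_le A (π.toFinset.erase ∅)
      omega

theorem app_main {Φ : PCNF} {n : ℕ} (hG : GoodF Φ n) (hn : 5 ≤ n) (π : List AClause)
    (hπ : IRRefutation Φ ∅ noSub π) : 18 ^ ((n+1) / 2) ≤ aSize π * 17 ^ ((n+1) / 2) := by
  obtain ⟨hv, hne, hlast⟩ := hπ
  refine le_trans ?_ (Nat.mul_le_mul_right _ (card_le_aSize π))
  refine core_main (Fin.last n) (FalsA n) (MonA n) ?_ ?_ ?_ π ?_ ?_ (by omega) _ ?_
  · intro c p hp
    simp only [MonA, Finset.mem_filter] at hp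
    exact hp.2.1
  · exact app_swap n
  · exact app_kill n
  · intro t ht
    have conv : ∀ B ∈ π.take t, ∃ s < t, π[s]! = B := by
      intro B hB
      rw [List.mem_take_iff_getElem] at hB
      obtain ⟨s, hs, e⟩ := hB
      refine ⟨s, by omega, ?_⟩
      rw [getElem!_pos π s (by omega)]; exact e
    rcases app_step hG (hv t ht) with h | ⟨B₁, h₁, B₂, h₂, h⟩
    · exact Or.inl h
    · right
      obtain ⟨s₁, hs₁, rfl⟩ := conv B₁ h₁
      obtain ⟨s₂, hs₂, rfl⟩ := conv B₂ h₂
      exact ⟨s₁, hs₁, s₂, hs₂, h⟩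
  · have hpos : 0 < π.length := List.length_pos_iff.2 hne
    refine ⟨π.length - 1, by omega, ?_⟩
    have : π[π.length - 1]! = ∅ := by
      rw [getElem!_pos π _ (by omega), ← hlast, List.getLast!_eq_getElem!, getElem!_pos π _ (by omega)]
    rw [this]
    intro σ a al hal
    simp at hal
  · intro c hc hM
    rw [Finset.mem_erase, List.mem_toFinset]
    refine ⟨?_, hc⟩
    rintro rfl
    obtain ⟨p, hp⟩ := hM
    simp [MonA] at hp

theorem poly_bound (q : Polynomial ℕ) : ∃ c d : ℕ, ∀ n : ℕ, 1 ≤ n → q.eval n ≤ c * n ^ d := by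
  refine ⟨q.sum fun _ a => a, q.natDegree, fun n hn => ?_⟩
  rw [Polynomial.eval_eq_sum, Polynomial.sum, Polynomial.sum, Finset.sum_mul]
  apply Finset.sum_le_sum
  intro i hi
  exact Nat.mul_le_mul_left _ (Nat.pow_le_pow_right hn (Polynomial.le_natDegree_of_mem_supp i hi))

theorem growth (q : Polynomial ℕ) : ∃ N : ℕ, ∀ n : ℕ, N ≤ n →
    q.eval n * 17 ^ ((n+1)/2) < 18 ^ ((n+1)/2) := by
  obtain ⟨c, d, h⟩ := poly_bound q
  have ht := tendsto_pow_const_div_const_pow_of_one_lt d (r := (18/17 : ℝ)) (by norm_num)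
  have hev := (tendsto_order.1 ht).2 (1 / ((c:ℝ) * 2 ^ d + 1)) (by positivity)
  obtain ⟨K, hK⟩ := Filter.eventually_atTop.1 hev
  refine ⟨2 * K + 1, fun n hn => ?_⟩
  set k := (n+1)/2 with hk
  have h1 := hK k (by omega)
  have h2 := h n (by omega)
  have h3 : n ^ d ≤ (2 * k) ^ d := Nat.pow_le_pow_left (by omega) d
  have h4 : q.eval n ≤ c * 2 ^ d * k ^ d := by
    calc q.eval n ≤ c * n ^ d := h2
      _ ≤ c * (2 * k) ^ d := Nat.mul_le_mul_left _ h3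
      _ = _ := by rw [mul_pow]; ring
  rw [div_lt_div_iff₀ (by positivity) (by positivity), div_pow, one_mul,
    lt_div_iff₀ (by positivity)] at h1
  have h5 : (k:ℝ) ^ d * (c * 2 ^ d + 1) * 17 ^ k < 18 ^ k := h1
  have h6 : k ^ d * (c * 2 ^ d + 1) * 17 ^ k < 18 ^ k := by exact_mod_cast h5
  refine lt_of_le_of_lt (Nat.mul_le_mul_right _ (h4.trans ?_)) h6
  nlinarith [Nat.zero_le (k ^ d)]

end Application


/-- every IR-calc refutation of Φ_n and of Ω_n has size
superpolynomial in n. -/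
theorem ircalc_superpolynomial_on_Phi_Omega :
    ∀ q : Polynomial ℕ, ∃ N : ℕ, ∀ n : ℕ, N ≤ n →
      (∀ π : List AClause, IRRefutation (PhiF n) ∅ noSub π → q.eval n < aSize π) ∧
      (∀ π : List AClause, IRRefutation (OmegaF n) ∅ noSub π → q.eval n < aSize π) := by
  intro q
  obtain ⟨N, hN⟩ := growth q
  refine ⟨max N 5, fun n hn => ?_⟩
  have h1 := hN n (le_trans (le_max_left _ _) hn)
  have h2 : 5 ≤ n := le_trans (le_max_right _ _) hn
  exact ⟨fun π hπ => lt_of_mul_lt_mul_right (h1.trans_le (app_main (good_Phi n) h2 π hπ))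
      (Nat.zero_le _),
    fun π hπ => lt_of_mul_lt_mul_right (h1.trans_le (app_main (good_Omega n) h2 π hπ))
      (Nat.zero_le _)⟩
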